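/- arXiv:2502.15315 — 3 statements merged into one kernel-verified Lean document; each statement's English description precedes it below -/
import Mathlib

section
/- Fix a dimension d ≥ 1, a number of clusters E ≥ 1, and a regularization strength λ > 0. For each cluster k ∈ {1,…,E} let s_{qk} ≥ 0 (q ∈ {1,…,d}) be nonnegative dispersion values, and suppose α_k is a real number such that s_{qk} + α_k > 0 for every q and ∑_{q=1}^d 1/(s_{qk} + α_k) = d/λ. Define w*_{qk} = (λ/d)/(s_{qk} + α_k). Then the family {w*_k}_{k=1}^E minimizes the objective Q({w_k}) = ∑_{k=1}^E ∑_{q=1}^d ( w_{qk} s_{qk} + (λ/d)·log(1/(d·w_{qk})) ) over all families of vectors {w_k}_{k=1}^E with w_{qk} > 0 for all q,k and ∑_{q=1}^d w_{qk} = 1 for every k. -/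
open Finset

/-- Tangent-line inequality for `w ↦ w * t + c * log (1 / (b * w))` at its critical point
`w = c / t`. -/
theorem mul_add_mul_log_one_div_le {b c t w : ℝ} (hb : 0 < b) (hc : 0 < c) (ht : 0 < t)
    (hw : 0 < w) :
    c / t * t + c * Real.log (1 / (b * (c / t))) ≤ w * t + c * Real.log (1 / (b * w)) := by
  have hv : 0 < c / t := div_pos hc ht
  have hlog := mul_le_mul_of_nonneg_left
    (Real.log_le_sub_one_of_pos (div_pos hw hv)) hc.le
  rw [Real.log_div hw.ne' hv.ne'] at hlog
  have hlin : c * (w / (c / t) - 1) = w * t - c := by field_simp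
  rw [one_div, one_div, Real.log_inv, Real.log_inv, Real.log_mul hb.ne' hv.ne',
    Real.log_mul hb.ne' hw.ne', div_mul_cancel₀ c ht.ne']
  linarith

/-- **Optimal feature weights** (Theorem 3.1 of "Tight Clusters Make Specialized Experts").
Given dispersions `s k q ≥ 0` and Lagrange multipliers `α k` with `s k q + α k > 0` and
`∑ q, 1/(s k q + α k) = d/λ`, the weights `w* k q = (λ/d)/(s k q + α k)` minimize the
feature-weighted clustering objective over all families of positive weight vectors on the
probability simplex. -/
theorem optimal_feature_weights (d E : ℕ) (hd : 1 ≤ d) (hE : 1 ≤ E)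
    (lam : ℝ) (hlam : 0 < lam)
    (s : Fin E → Fin d → ℝ) (hs : ∀ k q, 0 ≤ s k q)
    (α : Fin E → ℝ)
    (hpos : ∀ k q, 0 < s k q + α k)
    (halpha : ∀ k, ∑ q : Fin d, 1 / (s k q + α k) = d / lam)
    (wstar : Fin E → Fin d → ℝ)
    (hwstar : ∀ k q, wstar k q = (lam / d) / (s k q + α k))
    (Q : (Fin E → Fin d → ℝ) → ℝ)
    (hQ : ∀ w, Q w =
      ∑ k : Fin E, ∑ q : Fin d,
        (w k q * s k q + (lam / d) * Real.log (1 / (d * w k q)))) :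
    (∀ k q, 0 < wstar k q) ∧ (∀ k, ∑ q : Fin d, wstar k q = 1) ∧
      ∀ w : Fin E → Fin d → ℝ,
        (∀ k q, 0 < w k q) → (∀ k, ∑ q : Fin d, w k q = 1) →
        Q wstar ≤ Q w := by
  have hd0 : (0 : ℝ) < d := by exact_mod_cast hd
  have hc : 0 < lam / d := div_pos hlam hd0
  have hsum : ∀ k, ∑ q : Fin d, wstar k q = 1 := by
    intro k
    simp_rw [hwstar, div_eq_mul_one_div (lam / d : ℝ)]
    rw [← Finset.mul_sum, halpha]
    field_simp
  refine ⟨fun k q => hwstar k q ▸ div_pos hc (hpos k q), hsum, fun w hw hw1 => ?_⟩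
  rw [hQ, hQ]
  refine Finset.sum_le_sum fun k _ => ?_
  have hle : ∑ q : Fin d, (wstar k q * s k q + lam / d * Real.log (1 / (d * wstar k q))
        + wstar k q * α k) ≤
      ∑ q : Fin d, (w k q * s k q + lam / d * Real.log (1 / (d * w k q)) + w k q * α k) := by
    refine Finset.sum_le_sum fun q _ => ?_
    have h := mul_add_mul_log_one_div_le hd0 hc (hpos k q) (hw k q)
    rw [← hwstar] at h
    linarith
  rw [Finset.sum_add_distrib, Finset.sum_add_distrib (g := fun q => w k q * α k),
    ← Finset.sum_mul, ← Finset.sum_mul, hsum, hw1] at hle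
  linarith
end

section
/- Let d ≥ 1, λ > 0, and let s_1, …, s_d ≥ 0 be nonnegative reals with minimum s_min. Then there exists a unique α ∈ (−s_min, +∞) with ∑_{q=1}^d 1/(s_q + α) = d/λ. For this α one has s_q + α > 0 for every q, and the weights w_q = (λ/d)/(s_q + α) satisfy w_q > 0 for all q and ∑_{q=1}^d w_q = 1. -/
open Finset Set

section ReciprocalSum

variable {ι : Type*} {s : ι → ℝ} {a m : ℝ}

theorem add_pos_of_neg_lt_of_le (hm : ∀ q, m ≤ s q) (ha : -m < a) (q : ι) : 0 < s q + a := by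
  linarith [hm q]

variable [Fintype ι]

theorem strictAntiOn_sum_one_div_add [Nonempty ι] (hm : ∀ q, m ≤ s q) :
    StrictAntiOn (fun a => ∑ q, 1 / (s q + a)) (Set.Ioi (-m)) :=
  fun _ ha _ _ hab => Finset.sum_lt_sum_of_nonempty Finset.univ_nonempty fun q _ =>
    one_div_lt_one_div_of_lt (add_pos_of_neg_lt_of_le hm ha q) (by linarith)

theorem continuousOn_sum_one_div_add (hm : ∀ q, m ≤ s q) :
    ContinuousOn (fun a => ∑ q, 1 / (s q + a)) (Set.Ioi (-m)) :=
  continuousOn_finsetSum _ fun q _ =>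
    continuousOn_const.div (continuousOn_const.add continuousOn_id)
      fun _ ha => (add_pos_of_neg_lt_of_le hm ha q).ne'

theorem exists_sum_one_div_add_eq {c : ℝ} (hc : 0 < c) (hm : ∀ q, m ≤ s q)
    (hq : ∃ q, s q = m) : ∃ a ∈ Set.Ioi (-m), ∑ q, 1 / (s q + a) = c := by
  obtain ⟨p, hp⟩ := hq
  have hn : (1 : ℝ) ≤ Fintype.card ι := by
    exact_mod_cast Fintype.card_pos_iff.2 ⟨p⟩
  have hsub : Set.Icc (-m + 1 / c) (-m + Fintype.card ι / c) ⊆ Set.Ioi (-m) := fun x hx => by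
    have : 0 < 1 / c := by positivity
    exact Set.mem_Ioi.2 (by linarith [hx.1])
  have hle : -m + 1 / c ≤ -m + Fintype.card ι / c := by gcongr
  have hleft : c ≤ ∑ q, 1 / (s q + (-m + 1 / c)) := by
    have hterm : 1 / (s p + (-m + 1 / c)) = c := by
      rw [hp, add_neg_cancel_left, one_div_one_div]
    calc c = 1 / (s p + (-m + 1 / c)) := hterm.symm
      _ ≤ _ := Finset.single_le_sum (f := fun q => 1 / (s q + (-m + 1 / c)))
        (fun q _ => (one_div_pos.2 (add_pos_of_neg_lt_of_le hm
          (hsub (Set.left_mem_Icc.2 hle)) q)).le) (Finset.mem_univ p)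
  have hright : ∑ q, 1 / (s q + (-m + Fintype.card ι / c)) ≤ c := by
    calc ∑ q, 1 / (s q + (-m + Fintype.card ι / c))
        ≤ ∑ _q : ι, 1 / (Fintype.card ι / c) := by
          refine Finset.sum_le_sum fun q _ => one_div_le_one_div_of_le (by positivity) ?_
          linarith [hm q]
      _ = c := by
          rw [Finset.sum_const, Finset.card_univ, nsmul_eq_mul]
          field_simp
  obtain ⟨a, ha, hac⟩ := intermediate_value_Icc' hle
    ((continuousOn_sum_one_div_add hm).mono hsub) ⟨hright, hleft⟩
  exact ⟨a, hsub ha, hac⟩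

end ReciprocalSum

/-- The branch of Lemma A.1 used in Theorem 3.1: for nonnegative dispersions `s q` with
minimum `s_min` and `λ > 0`, there is a unique `α ∈ (−s_min, ∞)` with
`∑ q, 1/(s q + α) = d/λ`; for this `α` all `s q + α` are positive and the weights
`w q = (λ/d)/(s q + α)` are positive and sum to `1`. -/
theorem lagrange_multiplier_right_branch (d : ℕ) (hd : 1 ≤ d)
    (lam : ℝ) (hlam : 0 < lam)
    (s : Fin d → ℝ) (hs : ∀ q, 0 ≤ s q) :
    (∃! α : ℝ, α ∈ Set.Ioi (-(Finset.univ.inf' ⟨⟨0, by omega⟩, Finset.mem_univ _⟩ s)) ∧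
        ∑ q : Fin d, 1 / (s q + α) = d / lam) ∧
    (∀ α : ℝ,
      α ∈ Set.Ioi (-(Finset.univ.inf' ⟨⟨0, by omega⟩, Finset.mem_univ _⟩ s)) →
      (∑ q : Fin d, 1 / (s q + α) = d / lam) →
      (∀ q, 0 < s q + α) ∧ (∀ q, 0 < (lam / d) / (s q + α)) ∧
        ∑ q : Fin d, (lam / d) / (s q + α) = 1) := by
  have hne : (Finset.univ : Finset (Fin d)).Nonempty := ⟨⟨0, by omega⟩, Finset.mem_univ _⟩
  have hm : ∀ q, Finset.univ.inf' hne s ≤ s q := fun q => Finset.inf'_le _ (Finset.mem_univ q)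
  have hd0 : (0 : ℝ) < d := by exact_mod_cast hd
  have : Nonempty (Fin d) := ⟨⟨0, hd⟩⟩
  refine ⟨?_, fun a ha hsum => ?_⟩
  · obtain ⟨p, -, hp⟩ := Finset.exists_mem_eq_inf' hne s
    obtain ⟨a, ha, hsum⟩ := exists_sum_one_div_add_eq (div_pos hd0 hlam) hm ⟨p, hp.symm⟩
    exact ⟨a, ⟨ha, hsum⟩, fun b hb =>
      (strictAntiOn_sum_one_div_add hm).injOn hb.1 ha (hb.2.trans hsum.symm)⟩
  · have hpos := add_pos_of_neg_lt_of_le hm ha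
    refine ⟨hpos, fun q => div_pos (div_pos hlam hd0) (hpos q), ?_⟩
    simp_rw [div_eq_mul_one_div (lam / d), ← Finset.mul_sum, hsum]
    field_simp
end

section
/- Let d ≥ 2 and let Σ be a d×d real symmetric matrix with an orthonormal basis of eigenvectors v_1, …, v_d and corresponding real eigenvalues λ_1, …, λ_d. Let b_1, …, b_d denote the standard basis vectors of ℝ^d. Then for every index i: |λ_i − Σ_{ii}| ≤ (1 − ⟨v_i, b_i⟩²) · max_{j ≠ i} |λ_i − λ_j|. -/
open Finset Matrix

/-- If the rows of a square matrix are orthonormal, then so are its columns. -/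
theorem sum_mul_eq_ite_of_orthonormal_rows {n : Type*} [Fintype n] [DecidableEq n]
    {v : n → n → ℝ} (hv : ∀ j k, v j ⬝ᵥ v k = if j = k then (1 : ℝ) else 0) (a b : n) :
    ∑ j, v j a * v j b = if a = b then (1 : ℝ) else 0 := by
  have h : Matrix.of v * (Matrix.of v)ᵀ = 1 := by
    ext j k
    simpa [Matrix.mul_apply, Matrix.one_apply, dotProduct] using hv j k
  have h' := congrFun₂ (mul_eq_one_comm.mp h : (Matrix.of v)ᵀ * Matrix.of v = 1) a b
  simpa [Matrix.mul_apply, Matrix.one_apply] using h'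

/-- Spectral expansion of a diagonal entry in an orthonormal eigenbasis. -/
theorem diag_eq_sum_eigenvalue_mul_sq {n : Type*} [Fintype n] [DecidableEq n]
    {M : Matrix n n ℝ} {v : n → n → ℝ} {lam : n → ℝ}
    (hv : ∀ j k, v j ⬝ᵥ v k = if j = k then (1 : ℝ) else 0)
    (heig : ∀ j, M.mulVec (v j) = lam j • v j) (i : n) :
    M i i = ∑ j, lam j * v j i ^ 2 := by
  calc M i i = ∑ k, M i k * ∑ j, v j k * v j i := by
        simp [sum_mul_eq_ite_of_orthonormal_rows hv]
    _ = ∑ j, (M.mulVec (v j)) i * v j i := by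
        simp only [Matrix.mulVec, dotProduct, Finset.mul_sum, Finset.sum_mul, mul_assoc]
        exact Finset.sum_comm
    _ = ∑ j, lam j * v j i ^ 2 := by
        refine Finset.sum_congr rfl fun j _ => ?_
        rw [heig, Pi.smul_apply, smul_eq_mul]
        ring

/-- Intermediate bound in Lemma A.3: if `M` is symmetric with an orthonormal eigenbasis
`v` and eigenvalues `lam`, then for each `i`,
`|lam i − M i i| ≤ (1 − ⟨v i, b i⟩²) · max_{j ≠ i} |lam i − lam j|`. -/
theorem diagonal_entry_eigenvalue_bound (d : ℕ) (hd : 2 ≤ d)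
    (M : Matrix (Fin d) (Fin d) ℝ) (hM : M.IsSymm)
    (v : Fin d → Fin d → ℝ) (lam : Fin d → ℝ)
    (hortho : ∀ j k : Fin d, v j ⬝ᵥ v k = if j = k then (1 : ℝ) else 0)
    (heig : ∀ j : Fin d, M.mulVec (v j) = lam j • v j) :
    ∀ i : Fin d, |lam i - M i i| ≤
      (1 - (v i ⬝ᵥ Pi.single i (1 : ℝ)) ^ 2) *
        ((Finset.univ.erase i).sup'
          (by
            rw [← Finset.card_pos, Finset.card_erase_of_mem (Finset.mem_univ i),
              Finset.card_univ, Fintype.card_fin]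
            omega)
          fun j => |lam i - lam j|) := by
  intro i
  have hsq : ∑ j, v j i ^ 2 = 1 := by
    simpa [sq] using sum_mul_eq_ite_of_orthonormal_rows hortho i i
  have herase : ∑ j ∈ univ.erase i, v j i ^ 2 = 1 - v i i ^ 2 := by
    rw [← hsq, ← Finset.add_sum_erase univ _ (mem_univ i)]
    ring
  have hdiff : lam i - M i i = ∑ j ∈ univ.erase i, (lam i - lam j) * v j i ^ 2 := by
    rw [Finset.sum_erase _ (by simp), diag_eq_sum_eigenvalue_mul_sq hortho heig i]
    simp only [sub_mul, Finset.sum_sub_distrib, ← Finset.mul_sum, hsq, mul_one]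
  rw [dotProduct_single, mul_one, ← herase, hdiff, Finset.sum_mul]
  refine (Finset.abs_sum_le_sum_abs _ _).trans (Finset.sum_le_sum fun j hj => ?_)
  rw [abs_mul, abs_of_nonneg (sq_nonneg (v j i)), mul_comm]
  exact mul_le_mul_of_nonneg_left (Finset.le_sup' (fun j => |lam i - lam j|) hj) (sq_nonneg _)
end
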